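/- arXiv:2208.03184 — 4 statements merged into one kernel-verified Lean document; each statement's English description precedes it below -/
import Mathlib

section
/- Let K be a finite lattice, let t ∈ K be doubly irreducible with unique lower cover a (so a ⋖ t) and unique upper cover c (so t ⋖ c), and suppose there exists b ∈ K with b ≠ t and a ⋖ b ⋖ c. Let L = K \ {t} (a sublattice of K since t is doubly irreducible). If K = A ∪ B where A is an ideal of K, B is a filter of K, and A ∩ B is a nonempty chain, then, setting A' = A \ {t}, B' = B \ {t} and C' = A' ∩ B', we have: A' is a nonempty ideal of L, B' is a nonempty filter of L, C' is a nonempty chain, and L = A' ∪ B'. -/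
/-- An ideal of a lattice: a nonempty, downward-closed subset closed under binary joins. -/
def IsLatIdeal {α : Type*} [Lattice α] (S : Set α) : Prop :=
  S.Nonempty ∧ (∀ ⦃x y : α⦄, y ∈ S → x ≤ y → x ∈ S) ∧
    ∀ ⦃x y : α⦄, x ∈ S → y ∈ S → x ⊔ y ∈ S

/-- A filter of a lattice: a nonempty, upward-closed subset closed under binary meets. -/
def IsLatFilter {α : Type*} [Lattice α] (S : Set α) : Prop :=
  S.Nonempty ∧ (∀ ⦃x y : α⦄, y ∈ S → y ≤ x → x ∈ S) ∧
    ∀ ⦃x y : α⦄, x ∈ S → y ∈ S → x ⊓ y ∈ S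

/-- `t` is join-irreducible: not the bottom, and `t = x ⊔ y` implies `t = x` or `t = y`. -/
def JoinIrr {α : Type*} [Lattice α] [BoundedOrder α] (t : α) : Prop :=
  t ≠ ⊥ ∧ ∀ x y : α, t = x ⊔ y → t = x ∨ t = y

/-- `t` is meet-irreducible: not the top, and `t = x ⊓ y` implies `t = x` or `t = y`. -/
def MeetIrr {α : Type*} [Lattice α] [BoundedOrder α] (t : α) : Prop :=
  t ≠ ⊤ ∧ ∀ x y : α, t = x ⊓ y → t = x ∨ t = y

/-- `t` is doubly irreducible: join- and meet-irreducible, and neither bottom nor top. -/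
def DoublyIrr {α : Type*} [Lattice α] [BoundedOrder α] (t : α) : Prop :=
  JoinIrr t ∧ MeetIrr t ∧ t ≠ ⊥ ∧ t ≠ ⊤

theorem stmt_0 {α : Type*} [Lattice α] [Fintype α] [BoundedOrder α]
    (t a c b : α)
    (hIrr : DoublyIrr t)
    (hat : a ⋖ t) (ha_uniq : ∀ x : α, x ⋖ t → x = a)
    (htc : t ⋖ c) (hc_uniq : ∀ x : α, t ⋖ x → x = c)
    (hbt : b ≠ t) (hab : a ⋖ b) (hbc : b ⋖ c)
    (A B : Set α) (hA : IsLatIdeal A) (hB : IsLatFilter B)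
    (hcover : A ∪ B = Set.univ)
    (hABne : (A ∩ B).Nonempty) (hABchain : IsChain (· ≤ ·) (A ∩ B)) :
    -- L = K \ {t}, A' = A \ {t}, B' = B \ {t}, C' = A' ∩ B'
    -- A' is a nonempty ideal of L:
    ((A \ {t}).Nonempty ∧ (A \ {t}) ⊆ ({t}ᶜ : Set α) ∧
      (∀ ⦃x y : α⦄, y ∈ A \ {t} → x ∈ ({t}ᶜ : Set α) → x ≤ y → x ∈ A \ {t}) ∧
      (∀ ⦃x y : α⦄, x ∈ A \ {t} → y ∈ A \ {t} → x ⊔ y ∈ A \ {t})) ∧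
    -- B' is a nonempty filter of L:
    ((B \ {t}).Nonempty ∧ (B \ {t}) ⊆ ({t}ᶜ : Set α) ∧
      (∀ ⦃x y : α⦄, y ∈ B \ {t} → x ∈ ({t}ᶜ : Set α) → y ≤ x → x ∈ B \ {t}) ∧
      (∀ ⦃x y : α⦄, x ∈ B \ {t} → y ∈ B \ {t} → x ⊓ y ∈ B \ {t})) ∧
    -- C' is a nonempty chain:
    (((A \ {t}) ∩ (B \ {t})).Nonempty ∧ IsChain (· ≤ ·) ((A \ {t}) ∩ (B \ {t}))) ∧
    -- L = A' ∪ B':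
    (A \ {t}) ∪ (B \ {t}) = ({t}ᶜ : Set α) := by
  obtain ⟨-, hAdown, hAsup⟩ := hA
  obtain ⟨-, hBup, hBinf⟩ := hB
  obtain ⟨⟨-, hjoin⟩, ⟨-, hmeet⟩, -⟩ := hIrr
  have hne : ((A \ {t}) ∩ (B \ {t})).Nonempty := by
    obtain ⟨s, hsA, hsB⟩ := hABne
    by_cases hst : s = t
    · subst hst
      rcases (hcover ▸ Set.mem_univ b : b ∈ A ∪ B) with hb | hb
      · have h : s ⊔ b ≠ s := fun h =>
          hat.2 hab.1 (lt_of_le_of_ne (sup_eq_left.mp h) hbt)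
        exact ⟨s ⊔ b, ⟨hAsup hsA hb, h⟩, hBup hsB le_sup_left, h⟩
      · have h : s ⊓ b ≠ s := fun h =>
          htc.2 (lt_of_le_of_ne (inf_eq_left.mp h) hbt.symm) hbc.1
        exact ⟨s ⊓ b, ⟨hAdown hsA inf_le_left, h⟩, hBinf hsB hb, h⟩
    · exact ⟨s, ⟨hsA, hst⟩, hsB, hst⟩
  refine ⟨⟨hne.mono Set.inter_subset_left, fun x hx => hx.2,
      fun x y hy hx hxy => ⟨hAdown hy.1 hxy, hx⟩, fun x y hx hy => ⟨hAsup hx.1 hy.1, ?_⟩⟩,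
    ⟨hne.mono Set.inter_subset_right, fun x hx => hx.2,
      fun x y hy hx hxy => ⟨hBup hy.1 hxy, hx⟩, fun x y hx hy => ⟨hBinf hx.1 hy.1, ?_⟩⟩,
    ⟨hne, hABchain.mono (Set.inter_subset_inter Set.sdiff_subset Set.sdiff_subset)⟩, ?_⟩
  · intro h
    exact (hjoin x y h.symm).elim (fun e => hx.2 e.symm) (fun e => hy.2 e.symm)
  · intro h
    exact (hmeet x y h.symm).elim (fun e => hx.2 e.symm) (fun e => hy.2 e.symm)
  · rw [← Set.union_sdiff_distrib, hcover, Set.compl_eq_univ_sdiff]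
end

section
/- Let K be a finite lattice, let a, t, c ∈ K with a ⋖ t ⋖ c, and suppose there exists b ∈ K with b ≠ t and a ⋖ b ⋖ c. If A is an ideal of K, B is a filter of K, K = A ∪ B, and A ∩ B is nonempty, then (A ∩ B) \ {t} is nonempty; equivalently, A ∩ B ≠ {t}. -/
theorem CovBy.sup_eq_of_covBy_of_ne {α : Type*} [Lattice α] {x y z : α}
    (hxz : x ⋖ z) (hyz : y ⋖ z) (hxy : x ≠ y) : x ⊔ y = z := by
  rcases hxz.eq_or_eq le_sup_left (sup_le hxz.le hyz.le) with h | h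
  · have hyx : y < x := lt_of_le_of_ne (sup_eq_left.mp h) hxy.symm
    exact absurd hxz.lt (hyz.2 hyx)
  · exact h

theorem CovBy.inf_eq_of_covBy_of_ne {α : Type*} [Lattice α] {x y z : α}
    (hzx : z ⋖ x) (hzy : z ⋖ y) (hxy : x ≠ y) : x ⊓ y = z := by
  rcases hzx.eq_or_eq (le_inf hzx.le hzy.le) inf_le_left with h | h
  · exact h
  · have hxy' : x < y := lt_of_le_of_ne (inf_eq_left.mp h) hxy
    exact absurd hxy' (hzy.2 hzx.lt)

theorem stmt_3 {α : Type*} [Lattice α] [Fintype α]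
    (a t c b : α)
    (hat : a ⋖ t) (htc : t ⋖ c)
    (hbt : b ≠ t) (hab : a ⋖ b) (hbc : b ⋖ c)
    (A B : Set α) (hA : IsLatIdeal A) (hB : IsLatFilter B)
    (hcover : A ∪ B = Set.univ)
    (hne : (A ∩ B).Nonempty) :
    ((A ∩ B) \ {t}).Nonempty ∧ A ∩ B ≠ {t} := by
  have key : ((A ∩ B) \ {t}).Nonempty := by
    obtain ⟨s, hsA, hsB⟩ := hne
    by_cases hst : s = t
    · subst hst
      rcases hcover.symm ▸ Set.mem_univ b with hb | hb
      · have hcA := hA.2.2 hb hsA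
        rw [hbc.sup_eq_of_covBy_of_ne htc hbt] at hcA
        exact ⟨c, ⟨hcA, hB.2.1 hsB htc.le⟩, htc.ne'⟩
      · have haB := hB.2.2 hb hsB
        rw [hab.inf_eq_of_covBy_of_ne hat hbt] at haB
        exact ⟨a, ⟨hA.2.1 hsA hat.le, haB⟩, hat.ne⟩
    · exact ⟨s, ⟨hsA, hsB⟩, hst⟩
  refine ⟨key, fun h => ?_⟩
  simp [h] at key
end

section
/- (Semimodularity of the one-step extension.) Let K be a finite lattice, let t ∈ K, and set L = K \ {t}. Assume L is closed under the join and meet of K, and let a, b, c ∈ L satisfy a ⋖ b ⋖ c in L, with a meet-irreducible in L and c join-irreducible in L. Assume further that for every x ∈ L: x < t if and only if x ≤ a, and t < x if and only if c ≤ x. If L (with the induced lattice structure) is upper semimodular, then K is upper semimodular. -/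
/-- `y` covers `x` within the subset `S` (with the order induced from the ambient lattice):
`x < y` and no element of `S` lies strictly between them. -/
def CovIn {α : Type*} [Lattice α] (S : Set α) (x y : α) : Prop :=
  x < y ∧ ¬ ∃ z ∈ S, x < z ∧ z < y

theorem stmt_6 {α : Type*} [Lattice α] [Fintype α]
    (t : α) (L : Set α) (hL : L = ({t}ᶜ : Set α))
    -- L is closed under the join and meet of K:
    (hclosed : ∀ x ∈ L, ∀ y ∈ L, x ⊔ y ∈ L ∧ x ⊓ y ∈ L)
    (a b c : α) (haL : a ∈ L) (hbL : b ∈ L) (hcL : c ∈ L)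
    -- a ⋖ b ⋖ c in L:
    (hab : CovIn L a b) (hbc : CovIn L b c)
    -- a is meet-irreducible in L (not the top of L, not the meet of two strictly
    -- larger elements of L):
    (haMI : (∃ x ∈ L, a < x) ∧ ∀ x ∈ L, ∀ y ∈ L, a < x → a < y → x ⊓ y ≠ a)
    -- c is join-irreducible in L:
    (hcJI : (∃ x ∈ L, x < c) ∧ ∀ x ∈ L, ∀ y ∈ L, x < c → y < c → x ⊔ y ≠ c)
    -- the one-step extension conditions on t:
    (ht : ∀ x ∈ L, (x < t ↔ x ≤ a) ∧ (t < x ↔ c ≤ x))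
    -- L is upper semimodular:
    (hsm : ∀ x ∈ L, ∀ y ∈ L, CovIn L (x ⊓ y) x → CovIn L y (x ⊔ y)) :
    -- then K is upper semimodular:
    ∀ x y : α, x ⊓ y ⋖ x → y ⋖ x ⊔ y := by
  have hmem : ∀ z, z ≠ t → z ∈ L := fun z hz => by rw [hL]; exact hz
  have hne : ∀ z ∈ L, z ≠ t := fun z hz => by rw [hL] at hz; exact hz
  have eq_of_cov : ∀ {u v z : α}, CovIn L u v → z ∈ L → u < z → z ≤ v → z = v :=
    fun h hz huz hzv => by_contra fun hzne => h.2 ⟨_, hz, huz, lt_of_le_of_ne hzv hzne⟩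
  -- `b` is the least element of `L` above `a`
  have hb_le : ∀ z ∈ L, a < z → b ≤ z := by
    intro z hz haz
    have hlt : a < z ⊓ b := lt_of_le_of_ne (le_inf haz.le hab.1.le)
      (haMI.2 z hz b hbL haz hab.1).symm
    exact inf_eq_right.1 (eq_of_cov hab (hclosed z hz b hbL).2 hlt inf_le_right)
  have hat : a < t := (ht a haL).1.2 le_rfl
  have htc : t < c := (ht c hcL).2.2 le_rfl
  have le_a : ∀ z, z < t → z ≤ a := fun z hz => (ht z (hmem z hz.ne)).1.1 hz
  have c_le : ∀ z, t < z → c ≤ z := fun z hz => (ht z (hmem z hz.ne')).2.1 hz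
  intro x y hxy
  by_cases hx : x = t
  · subst hx
    have hma : x ⊓ y = a := by
      by_contra hne'
      exact hxy.2 (lt_of_le_of_ne (le_a _ hxy.1) hne') hat
    have hay : a ≤ y := hma ▸ inf_le_right
    rcases hay.eq_or_lt with hay | hay
    · rw [← hay, sup_eq_left.2 hat.le, ← hma]
      exact hxy
    have hxy' : ¬ x ≤ y := fun h => hxy.1.ne (inf_eq_left.2 h)
    have hyL : y ∈ L := hmem y fun h => hxy' h.ge
    have hyx : ¬ y ≤ x := fun h =>
      absurd (le_a y (lt_of_le_of_ne h (hne y hyL))) (not_le_of_gt hay)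
    have hcj : c ≤ x ⊔ y := c_le _ (left_lt_sup.2 hyx)
    have hj : c ⊔ y = x ⊔ y := le_antisymm (sup_le hcj le_sup_right) (sup_le_sup_right htc.le y)
    have hcy : c ⊓ y = b := by
      by_contra h
      have hlt : b < c ⊓ y := lt_of_le_of_ne (le_inf hbc.1.le (hb_le y hyL hay)) (Ne.symm h)
      have := eq_of_cov hbc (hclosed c hcL y hyL).2 hlt inf_le_left
      exact hxy' (htc.le.trans (inf_eq_left.1 this))
    have hcov := hsm c hcL y hyL (hcy.symm ▸ hbc)
    rw [hj] at hcov
    exact ⟨hcov.1, fun z hz hz' => hcov.2 ⟨z, hmem z fun h => hyx (h ▸ hz.le), hz, hz'⟩⟩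
  have hxL := hmem x hx
  by_cases hy : y = t
  · subst hy
    by_cases hyx : y ≤ x
    · rwa [sup_eq_left.2 hyx, ← inf_eq_right.2 hyx]
    have hm : x ⊓ y = x ⊓ a := le_antisymm
      (le_inf inf_le_left (le_a _ (inf_lt_right.2 hyx))) (inf_le_inf_left x hat.le)
    rw [hm] at hxy
    have hcov := hsm x hxL a haL ⟨hxy.1, fun ⟨z, _, h, h'⟩ => hxy.2 h h'⟩
    have hj : b = x ⊔ a := eq_of_cov hcov hbL hab.1 (hb_le _ (hclosed x hxL a haL).1 hcov.1)
    have hxc : x ≤ c := (hj ▸ le_sup_left : x ≤ b).trans hbc.1.le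
    have hxy' : ¬ x ≤ y := fun h =>
      hcov.1.ne (sup_eq_right.2 (le_a x (lt_of_le_of_ne h hx))).symm
    have hjc : x ⊔ y = c := le_antisymm (sup_le hxc htc.le) (c_le _ (right_lt_sup.2 hxy'))
    rw [hjc]
    exact ⟨htc, fun z hz hz' => (c_le z hz).not_gt hz'⟩
  have hcov := hsm x hxL y (hmem y hy) ⟨hxy.1, fun ⟨z, _, h, h'⟩ => hxy.2 h h'⟩
  refine ⟨hcov.1, fun z hz hz' => ?_⟩
  by_cases hzt : z = t
  · subst hzt
    exact hcov.2 ⟨b, hbL, (le_a y hz).trans_lt hab.1, hbc.1.trans_le (c_le _ hz')⟩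
  · exact hcov.2 ⟨z, hmem z hzt, hz, hz'⟩
end

section
/- (The one-step extension preserves slimness.) Let K be a finite lattice, let t ∈ K, and set L = K \ {t}. Assume L is closed under the join and meet of K, and let a, b, c ∈ L satisfy a ⋖ b ⋖ c in L, with a meet-irreducible in L and c join-irreducible in L. Assume further that for every x ∈ L: x < t if and only if x ≤ a, and t < x if and only if c ≤ x. If L contains no cover-preserving M₃, then K contains no cover-preserving M₃. -/
theorem CovBy.covIn {α : Type*} [Lattice α] {x y : α} (h : x ⋖ y) (S : Set α) : CovIn S x y :=
  ⟨h.lt, fun ⟨_, _, hxz, hzy⟩ => h.2 hxz hzy⟩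

/-- A meet-irreducible element of a meet-closed subset has at most one cover in it, and that cover
lies below every strictly larger element of the subset. -/
theorem CovIn.le_of_lt_of_inf_ne {α : Type*} [Lattice α] {S : Set α} {a b x : α}
    (hab : CovIn S a b) (hx : x ⊓ b ∈ S) (hax : a < x) (hne : x ⊓ b ≠ a) : b ≤ x := by
  by_contra hbx
  exact hab.2 ⟨x ⊓ b, hx, lt_of_le_of_ne (le_inf hax.le hab.1.le) hne.symm, inf_lt_right.2 hbx⟩

/-- The dual of `CovIn.le_of_lt_of_inf_ne`. -/
theorem CovIn.le_of_lt_of_sup_ne {α : Type*} [Lattice α] {S : Set α} {b c x : α}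
    (hbc : CovIn S b c) (hx : x ⊔ b ∈ S) (hxc : x < c) (hne : x ⊔ b ≠ c) : x ≤ b := by
  by_contra hxb
  exact hbc.2 ⟨x ⊔ b, hx, right_lt_sup.2 hxb, lt_of_le_of_ne (sup_le hxc.le hbc.1.le) hne⟩

theorem stmt_7 {α : Type*} [Lattice α] [Fintype α]
    (t : α) (L : Set α) (hL : L = ({t}ᶜ : Set α))
    -- L is closed under the join and meet of K:
    (hclosed : ∀ x ∈ L, ∀ y ∈ L, x ⊔ y ∈ L ∧ x ⊓ y ∈ L)
    (a b c : α) (haL : a ∈ L) (hbL : b ∈ L) (hcL : c ∈ L)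
    -- a ⋖ b ⋖ c in L:
    (hab : CovIn L a b) (hbc : CovIn L b c)
    -- a is meet-irreducible in L:
    (haMI : (∃ x ∈ L, a < x) ∧ ∀ x ∈ L, ∀ y ∈ L, a < x → a < y → x ⊓ y ≠ a)
    -- c is join-irreducible in L:
    (hcJI : (∃ x ∈ L, x < c) ∧ ∀ x ∈ L, ∀ y ∈ L, x < c → y < c → x ⊔ y ≠ c)
    -- the one-step extension conditions on t:
    (ht : ∀ x ∈ L, (x < t ↔ x ≤ a) ∧ (t < x ↔ c ≤ x))
    -- L contains no cover-preserving M₃: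
    (hslim : ¬ ∃ o u v w i : α, o ∈ L ∧ u ∈ L ∧ v ∈ L ∧ w ∈ L ∧ i ∈ L ∧
      u ≠ v ∧ u ≠ w ∧ v ≠ w ∧
      CovIn L o u ∧ CovIn L o v ∧ CovIn L o w ∧
      CovIn L u i ∧ CovIn L v i ∧ CovIn L w i) :
    -- then K contains no cover-preserving M₃:
    ¬ ∃ o u v w i : α, u ≠ v ∧ u ≠ w ∧ v ≠ w ∧
      o ⋖ u ∧ o ⋖ v ∧ o ⋖ w ∧ u ⋖ i ∧ v ⋖ i ∧ w ⋖ i := by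
  have memL : ∀ {x : α}, x ≠ t → x ∈ L := fun {x} hx => by
    rw [hL]
    exact hx
  have hat : a < t := (ht a haL).1.2 le_rfl
  have htc : t < c := (ht c hcL).2.2 le_rfl
  have lower : ∀ {x : α}, x ⋖ t → x = a := fun {x} hx =>
    (hx.eq_or_eq ((ht x (memL hx.ne)).1.1 hx.lt) hat.le).resolve_right hat.ne |>.symm
  have upper : ∀ {x : α}, t ⋖ x → x = c := fun {x} hx =>
    (hx.eq_or_eq htc.le ((ht x (memL hx.ne')).2.1 hx.lt)).resolve_left htc.ne' |>.symm
  have between : ∀ {x : α}, x ∈ L → a < x → x < c → x = b := fun {x} hx hax hxc =>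
    le_antisymm
      (hbc.le_of_lt_of_sup_ne (hclosed x hx b hbL).1 hxc (hcJI.2 x hx b hbL hxc hbc.1))
      (hab.le_of_lt_of_inf_ne (hclosed x hx b hbL).2 hax (haMI.2 x hx b hbL hax hab.1))
  have not_middle : ∀ {o v w i : α}, t ≠ v → t ≠ w → v ≠ w → o ⋖ t → o ⋖ v → o ⋖ w →
      t ⋖ i → v ⋖ i → w ⋖ i → False := by
    intro o v w i htv htw hvw hot hov how hti hvi hwi
    obtain rfl := lower hot
    obtain rfl := upper hti
    exact hvw ((between (memL htv.symm) hov.lt hvi.lt).trans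
      (between (memL htw.symm) how.lt hwi.lt).symm)
  rintro ⟨o, u, v, w, i, huv, huw, hvw, hou, hov, how, hui, hvi, hwi⟩
  have ho : o ≠ t := by
    rintro rfl
    exact huv ((upper hou).trans (upper hov).symm)
  have hi : i ≠ t := by
    rintro rfl
    exact huv ((lower hui).trans (lower hvi).symm)
  have hu : u ≠ t := by
    rintro rfl
    exact not_middle huv huw hvw hou hov how hui hvi hwi
  have hv : v ≠ t := by
    rintro rfl
    exact not_middle huv.symm hvw huw hov hou how hvi hui hwi
  have hw : w ≠ t := by
    rintro rfl
    exact not_middle huw.symm hvw.symm huv how hou hov hwi hui hvi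
  exact hslim ⟨o, u, v, w, i, memL ho, memL hu, memL hv, memL hw, memL hi, huv, huw, hvw,
    hou.covIn L, hov.covIn L, how.covIn L, hui.covIn L, hvi.covIn L, hwi.covIn L⟩
end
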